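/- Let E be a real normed vector space, let (Θ, 𝒫) be a probability space, and let H : ℕ → E → E, L ≥ 0, C ≥ 0, C₂ ≥ 0, δ > 0, ε > 0, Δt > 0, T > 0, p ∈ ℕ and m ∈ ℕ (the total number of degrees of freedom, m = d_u·M·J_n in the paper, with d_u ≥ 1). Let y : ℕ → E be the exact solution values and define u : ℕ → E by u(0) = y(0) and u(n+1) = u(n) + Δt·H(n, u(n)). Assume: (i) ‖H(n, a) − H(n, b)‖ ≤ L‖a − b‖ for all n and a, b ∈ E; (ii) ‖y(n+1) − y(n) − Δt·H(n, y(n))‖ ≤ C·Δt^{p+1} for all n; (iii) a sequence of 'optimal' approximations ũ : ℕ → E satisfies ‖ũ(n) − u(n)‖ ≤ √(d_u)·ε for all n; (iv) a sequence of random 'numerical' approximations û : ℕ → Θ → E satisfies, for every n, that θ ↦ ‖û(n, θ) − ũ(n)‖ is integrable with E_𝒫[‖û(n, ·) − ũ(n)‖] ≤ C₂·√m·δ. Then for every n with n·Δt ≤ T, E_𝒫[‖û(n, ·) − y(n)‖] ≤ C₂·√m·δ + √(d_u)·ε + C·T·e^{L·T}·Δt^{p}. -/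

import Mathlib

open MeasureTheory

/-- Global error estimate for the fully discrete IMEX-RK random feature method:
the expected error splits into the coefficient-perturbation term `C₂·√m·δ`, the
stage-wise approximation term `√d_u·ε`, and the time-discretization term
`C·T·e^{L·T}·Δt^p`. -/
theorem imex_rfm_global_error
    {E : Type*} [NormedAddCommGroup E] [NormedSpace ℝ E]
    {Θ : Type*} [MeasurableSpace Θ] (P : Measure Θ) [IsProbabilityMeasure P]
    (H : ℕ → E → E) (L C C₂ δ ε Δt T : ℝ) (p m d_u : ℕ)
    (hL : 0 ≤ L) (hC : 0 ≤ C) (hC₂ : 0 ≤ C₂) (hδ : 0 < δ) (hε : 0 < ε)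
    (hΔt : 0 < Δt) (hT : 0 < T) (hdu : 1 ≤ d_u)
    (y u : ℕ → E) (hu0 : u 0 = y 0)
    (hustep : ∀ n : ℕ, u (n + 1) = u n + Δt • H n (u n))
    (hLip : ∀ (n : ℕ) (a b : E), ‖H n a - H n b‖ ≤ L * ‖a - b‖)
    (hloc : ∀ n : ℕ, ‖y (n + 1) - y n - Δt • H n (y n)‖ ≤ C * Δt ^ (p + 1))
    (uopt : ℕ → E)
    (hopt : ∀ n : ℕ, ‖uopt n - u n‖ ≤ Real.sqrt d_u * ε)
    (unum : ℕ → Θ → E)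
    (hint : ∀ n : ℕ, Integrable (fun θ => ‖unum n θ - uopt n‖) P)
    (hpert : ∀ n : ℕ, ∫ θ, ‖unum n θ - uopt n‖ ∂P ≤ C₂ * Real.sqrt m * δ) :
    ∀ n : ℕ, (n : ℝ) * Δt ≤ T →
      ∫ θ, ‖unum n θ - y n‖ ∂P ≤
        C₂ * Real.sqrt m * δ + Real.sqrt d_u * ε +
          C * T * Real.exp (L * T) * Δt ^ p := by
  have key : ∀ n : ℕ, ‖u n - y n‖ ≤ n * (C * Δt ^ (p + 1)) * Real.exp (L * (n * Δt)) := by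
    intro n
    induction n with
    | zero => simp [hu0]
    | succ n ih =>
      have hK : 0 ≤ C * Δt ^ (p + 1) := by positivity
      have h1 : u (n + 1) - y (n + 1) = (u n - y n) + Δt • (H n (u n) - H n (y n))
          - (y (n + 1) - y n - Δt • H n (y n)) := by
        rw [hustep, smul_sub]; abel
      have h2 : ‖u (n + 1) - y (n + 1)‖ ≤
          ‖u n - y n‖ + Δt * (L * ‖u n - y n‖) + C * Δt ^ (p + 1) := by
        rw [h1]
        refine (norm_sub_le _ _).trans (add_le_add ((norm_add_le _ _).trans ?_) (hloc n))
        rw [norm_smul, Real.norm_of_nonneg hΔt.le]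
        gcongr
        exact hLip n _ _
      have h3 : 1 + L * Δt ≤ Real.exp (L * Δt) := by
        have := Real.add_one_le_exp (L * Δt)
        linarith
      have h4 : Real.exp (L * ((n + 1 : ℕ) * Δt)) =
          Real.exp (L * Δt) * Real.exp (L * (n * Δt)) := by
        rw [← Real.exp_add]; congr 1; push_cast; ring
      have h5 : 1 ≤ Real.exp (L * ((n + 1 : ℕ) * Δt)) := Real.one_le_exp (by positivity)
      have h6 : (1 + L * Δt) * ‖u n - y n‖ ≤
          Real.exp (L * Δt) * (n * (C * Δt ^ (p + 1)) * Real.exp (L * (n * Δt))) := by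
        gcongr
      have h7 := mul_le_mul_of_nonneg_left h5 hK
      calc _ ≤ (1 + L * Δt) * ‖u n - y n‖ + C * Δt ^ (p + 1) * 1 := by linarith
        _ ≤ _ := add_le_add h6 h7
        _ = _ := by rw [h4]; push_cast; ring
  intro n hn
  have hu : ‖u n - y n‖ ≤ C * T * Real.exp (L * T) * Δt ^ p := by
    calc _ ≤ _ := key n
      _ = C * (n * Δt) * Real.exp (L * (n * Δt)) * Δt ^ p := by ring
      _ ≤ _ := by gcongr
  have hpt : ∀ θ, ‖unum n θ - y n‖ ≤ ‖unum n θ - uopt n‖ +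
      (Real.sqrt d_u * ε + C * T * Real.exp (L * T) * Δt ^ p) := by
    intro θ
    have e : unum n θ - y n = (unum n θ - uopt n) + ((uopt n - u n) + (u n - y n)) := by abel
    rw [e]
    refine (norm_add_le _ _).trans (add_le_add le_rfl ?_)
    exact (norm_add_le _ _).trans (add_le_add (hopt n) hu)
  have hm := integral_mono_of_nonneg (μ := P)
    (Filter.Eventually.of_forall fun θ => norm_nonneg (unum n θ - y n))
    ((hint n).add (integrable_const
      (Real.sqrt d_u * ε + C * T * Real.exp (L * T) * Δt ^ p)))
    (Filter.Eventually.of_forall hpt)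
  refine hm.trans ?_
  have hs := integral_add (hint n) (integrable_const (μ := P)
      (Real.sqrt d_u * ε + C * T * Real.exp (L * T) * Δt ^ p))
  simp only [Pi.add_apply]
  rw [hs, integral_const]
  simp only [probReal_univ, one_smul]
  linarith [hpert n]
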